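/- Let π be a checking sequence and e_b a block addable to π with test(e_b) < 0. Then for every set S of blocks addable to π (with pairwise distinct password indices) whose last element in natural ordering is e_b, one has U(π ∪ S) < U(π ∪ (S ∖ {e_b})); in particular, if Δ(S|π) ≥ 0 then Δ(S ∖ {e_b} | π) > 0. -/

import Mathlib

noncomputable section

/-- Parameters of the cost-asymmetric memory-hard password hashing model:
`n` passwords with probabilities `p 1 >= ... >= p n`, `m` breakpoints with
probabilities `q 1, ..., q m`, running-time breakpoints `t 0 < t 1 < ... < t m`,
memory-cost constant `cM` and password value `v`. -/
structure Params where
  n : ℕ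
  m : ℕ
  p : ℕ → ℝ
  q : ℕ → ℝ
  t : ℕ → ℝ
  cM : ℝ
  v : ℝ

namespace Params

/-- The standing hypotheses on the parameters. -/
structure Hyp (P : Params) : Prop where
  hn : 1 ≤ P.n
  hm : 1 ≤ P.m
  p_pos : ∀ i ∈ Finset.Icc 1 P.n, 0 < P.p i
  p_anti : ∀ i ∈ Finset.Icc 1 P.n, ∀ i' ∈ Finset.Icc 1 P.n, i ≤ i' → P.p i' ≤ P.p i
  p_sum : ∑ i ∈ Finset.Icc 1 P.n, P.p i ≤ 1
  q_nonneg : ∀ j ∈ Finset.Icc 1 P.m, 0 ≤ P.q j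
  q_sum : ∑ j ∈ Finset.Icc 1 P.m, P.q j = 1
  t_zero : P.t 0 = 0
  t_mono : ∀ j j', j < j' → j' ≤ P.m → P.t j < P.t j'
  cM_pos : 0 < P.cM
  v_pos : 0 < P.v

/-- Cumulative breakpoint probability `Q j = q 1 + ... + q j`. -/
def Q (P : Params) (j : ℕ) : ℝ := ∑ j' ∈ Finset.Icc 1 j, P.q j'

/-- Round cost `c(i, j) = cM * (t j ^ 2 - t (j-1) ^ 2)` of executing an
instruction with label index `j` (it does not depend on the password index). -/
def rc (P : Params) (j : ℕ) : ℝ := P.cM * (P.t j ^ 2 - P.t (j - 1) ^ 2)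

/-- A checking sequence is determined by its exponent vector `τ`: for each
password `i ∈ [1, n]` the attacker executes the instructions
`(i, 1), ..., (i, τ i)`, passwords being processed in increasing order.
`τ` is valid if `τ i ≤ m` for all `i` and `τ i = 0` outside `[1, n]`. -/
def Valid (P : Params) (τ : ℕ → ℕ) : Prop :=
  (∀ i, τ i ≤ P.m) ∧ ∀ i, i ∉ Finset.Icc 1 P.n → τ i = 0

/-- Success probability `λ(π)` of the checking sequence with exponent vector `τ`. -/
def lam (P : Params) (τ : ℕ → ℕ) : ℝ := ∑ i ∈ Finset.Icc 1 P.n, P.p i * P.Q (τ i)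

/-- Probability mass `λ(π, k-1)` of the instructions strictly preceding the
instruction `(i, j)` in the checking sequence with exponent vector `τ`. -/
def lamBefore (P : Params) (τ : ℕ → ℕ) (i j : ℕ) : ℝ :=
  (∑ i' ∈ Finset.Ico 1 i, P.p i' * P.Q (τ i')) + P.p i * P.Q (j - 1)

/-- Attacker's utility `U(π) = v·λ(π) - Σ_k c(π_k)·(1 - λ(π, k-1))`. -/
def U (P : Params) (τ : ℕ → ℕ) : ℝ :=
  P.v * P.lam τ -
    ∑ i ∈ Finset.Icc 1 P.n, ∑ j ∈ Finset.Icc 1 (τ i), P.rc j * (1 - P.lamBefore τ i j)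

/-- A checking sequence is optimal if it maximizes the attacker's utility. -/
def Optimal (P : Params) (τ : ℕ → ℕ) : Prop :=
  P.Valid τ ∧ ∀ τ', P.Valid τ' → P.U τ' ≤ P.U τ

/-- `π ⊆ π'` for checking sequences: `τ i ≤ τ' i` for all `i`. -/
def Subseq (P : Params) (τ τ' : ℕ → ℕ) : Prop := ∀ i, τ i ≤ τ' i

lemma Hyp.rc_nonneg {P : Params} (hP : P.Hyp) {j : ℕ} (h1 : 1 ≤ j) (hj : j ≤ P.m) :
    0 ≤ P.rc j := by
  have hlt : P.t (j - 1) < P.t j := hP.t_mono _ _ (by omega) hj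
  have h0 : 0 ≤ P.t (j - 1) := by
    rcases Nat.eq_zero_or_pos (j - 1) with h | h
    · rw [h, hP.t_zero]
    · rw [← hP.t_zero]
      exact (hP.t_mono 0 _ h (by omega)).le
  exact mul_nonneg hP.cM_pos.le (by nlinarith)

lemma Hyp.Q_mono {P : Params} (hP : P.Hyp) {j k : ℕ} (hjk : j ≤ k) (hk : k ≤ P.m) :
    P.Q j ≤ P.Q k := by
  refine Finset.sum_le_sum_of_subset_of_nonneg (Finset.Icc_subset_Icc_right hjk) fun i hi _ => ?_
  exact hP.q_nonneg i (Finset.Icc_subset_Icc_right hk hi)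

/-- The cost of processing one password, with the mass of the earlier passwords factored out. -/
lemma sum_rc_mul_one_sub_lamBefore (P : Params) (τ : ℕ → ℕ) (i k : ℕ) :
    ∑ j ∈ Finset.Icc 1 k, P.rc j * (1 - P.lamBefore τ i j) =
      (∑ j ∈ Finset.Icc 1 k, P.rc j) * (1 - ∑ i' ∈ Finset.Ico 1 i, P.p i' * P.Q (τ i')) -
        P.p i * ∑ j ∈ Finset.Icc 1 k, P.rc j * P.Q (j - 1) := by
  rw [Finset.sum_mul, Finset.mul_sum, ← Finset.sum_sub_distrib]
  refine Finset.sum_congr rfl fun j _ => ?_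
  rw [lamBefore]
  ring

lemma sum_Icc_one_sub (f : ℕ → ℝ) {k j : ℕ} (h : k ≤ j) :
    ∑ i ∈ Finset.Icc 1 j, f i - ∑ i ∈ Finset.Icc 1 k, f i = ∑ i ∈ Finset.Icc (k + 1) j, f i := by
  have hI (a b : ℕ) : Finset.Icc (a + 1) b = Finset.Ioc a b := by
    ext; simp only [Finset.mem_Icc, Finset.mem_Ioc]; omega
  rw [hI k j, ← zero_add 1, hI, hI, ← Finset.sum_Ioc_consecutive f (Nat.zero_le k) h]
  ring

/-- The marginal utilities of the same block relative to two checking sequences that agree from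
its password on differ by its cost times the difference of the masses of the earlier passwords. -/
lemma marginal_sub_marginal (P : Params) (τ ρ : ℕ → ℕ) {b j : ℕ} (hb : b ∈ Finset.Icc 1 P.n)
    (hj : τ b ≤ j) (hρ : ∀ i, b ≤ i → ρ i = τ i) :
    (P.U (Function.update ρ b j) - P.U ρ) - (P.U (Function.update τ b j) - P.U τ) =
      (∑ i ∈ Finset.Ico 1 b, P.p i * (P.Q (ρ i) - P.Q (τ i))) *
        ∑ k ∈ Finset.Icc (τ b + 1) j, P.rc k := by
  have hterm (i : ℕ) : P.Q (Function.update ρ b j i) - P.Q (ρ i) =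
      P.Q (Function.update τ b j i) - P.Q (τ i) := by
    rcases eq_or_ne i b with rfl | h
    · simp [hρ i le_rfl]
    · simp [Function.update_of_ne h]
  have hmass (s : Finset ℕ) : ∑ i ∈ s, P.p i * P.Q (Function.update ρ b j i) =
      ∑ i ∈ s, P.p i * P.Q (Function.update τ b j i) + ∑ i ∈ s, P.p i * P.Q (ρ i) -
        ∑ i ∈ s, P.p i * P.Q (τ i) := by
    rw [← Finset.sum_add_distrib, ← Finset.sum_sub_distrib]
    refine Finset.sum_congr rfl fun i _ => ?_
    linear_combination P.p i * hterm i
  have hbefore (σ : ℕ → ℕ) (i : ℕ) (hi : i ≤ b) :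
      ∑ i' ∈ Finset.Ico 1 i, P.p i' * P.Q (Function.update σ b j i') =
        ∑ i' ∈ Finset.Ico 1 i, P.p i' * P.Q (σ i') := by
    refine Finset.sum_congr rfl fun i' hi' => ?_
    rw [Function.update_of_ne]
    have := (Finset.mem_Ico.1 hi').2
    omega
  let cost (σ : ℕ → ℕ) (i : ℕ) : ℝ :=
    ∑ k ∈ Finset.Icc 1 (σ i), P.rc k * (1 - P.lamBefore σ i k)
  have hcost : ∑ i ∈ Finset.Icc 1 P.n, (cost (Function.update τ b j) i - cost τ i -
      (cost (Function.update ρ b j) i - cost ρ i)) =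
      (∑ i ∈ Finset.Ico 1 b, P.p i * (P.Q (ρ i) - P.Q (τ i))) *
        ∑ k ∈ Finset.Icc (τ b + 1) j, P.rc k := by
    rw [Finset.sum_eq_single_of_mem b hb]
    · simp only [cost, sum_rc_mul_one_sub_lamBefore, hbefore _ b le_rfl, Function.update_self,
        hρ b le_rfl, ← sum_Icc_one_sub P.rc hj]
      simp only [mul_sub, Finset.sum_sub_distrib]
      ring
    · intro i _ hi
      simp only [cost, sum_rc_mul_one_sub_lamBefore, Function.update_of_ne hi]
      rcases lt_or_gt_of_ne hi with h | h
      · rw [hbefore _ i h.le, hbefore _ i h.le]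
        ring
      · rw [hρ i h.le, hmass]
        ring
  rw [← hcost]
  simp only [Finset.sum_sub_distrib, U, lam, hmass (Finset.Icc 1 P.n), cost]
  ring

/-- if `test(e_b) < 0` for a block `e_b = ϖ_{i_b}(τ i_b + 1, j_b)`
addable to `π`, then for every addable set `S` (indices `I`, targets `σ`) whose
last block is `e_b`, removing `e_b` strictly increases the utility; in
particular if `Δ(S|π) ≥ 0` then `Δ(S \ {e_b}|π) > 0`. -/
theorem statement12 (P : Params) (hP : P.Hyp) (τ : ℕ → ℕ) (hτ : P.Valid τ)
    (ib jb : ℕ) (hib : ib ∈ Finset.Icc 1 P.n) (hjb1 : τ ib < jb) (hjb2 : jb ≤ P.m)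
    (htest :
      (P.U (Function.update τ ib jb) - P.U τ) +
          (∑ i' ∈ Finset.Ico 1 ib, P.p i' * (P.Q P.m - P.Q (τ i'))) *
            (∑ j ∈ Finset.Icc (τ ib + 1) jb, P.rc j) < 0)
    (I : Finset ℕ) (hI : I ⊆ Finset.Icc 1 P.n) (σ : ℕ → ℕ)
    (hadd : ∀ i ∈ I, τ i < σ i ∧ σ i ≤ P.m)
    (hbmem : ib ∈ I) (hσb : σ ib = jb) (hlast : ∀ i ∈ I, i ≤ ib) :
    P.U (fun i => if i ∈ I then σ i else τ i) <
        P.U (fun i => if i ∈ I.erase ib then σ i else τ i) ∧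
      (0 ≤ P.U (fun i => if i ∈ I then σ i else τ i) - P.U τ →
        0 < P.U (fun i => if i ∈ I.erase ib then σ i else τ i) - P.U τ) := by
  set ρ : ℕ → ℕ := fun i => if i ∈ I.erase ib then σ i else τ i with hρ_def
  have hupd : (fun i => if i ∈ I then σ i else τ i) = Function.update ρ ib jb := by
    ext i
    rcases eq_or_ne i ib with rfl | h
    · simp [hbmem, hσb]
    · simp [hρ_def, h]
  have hρ : ∀ i, ib ≤ i → ρ i = τ i := by
    intro i hi
    refine if_neg fun hmem => ?_
    obtain ⟨hne, hmem⟩ := Finset.mem_erase.1 hmem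
    exact hne (le_antisymm (hlast i hmem) hi)
  have hρm : ∀ i, ρ i ≤ P.m := by
    intro i
    simp only [hρ_def]
    split_ifs with h
    · exact (hadd i (Finset.mem_of_mem_erase h)).2
    · exact hτ.1 i
  have hcost : 0 ≤ ∑ j ∈ Finset.Icc (τ ib + 1) jb, P.rc j := by
    refine Finset.sum_nonneg fun j hj => ?_
    rw [Finset.mem_Icc] at hj
    exact hP.rc_nonneg (by omega) (by omega)
  have hmass : ∑ i ∈ Finset.Ico 1 ib, P.p i * (P.Q (ρ i) - P.Q (τ i)) ≤
      ∑ i ∈ Finset.Ico 1 ib, P.p i * (P.Q P.m - P.Q (τ i)) := by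
    refine Finset.sum_le_sum fun i hi => ?_
    rw [Finset.mem_Ico] at hi
    have hp := hP.p_pos i (Finset.mem_Icc.2 ⟨hi.1, hi.2.le.trans (Finset.mem_Icc.1 hib).2⟩)
    have hQ := hP.Q_mono (hρm i) le_rfl
    gcongr
  have hdiff := P.marginal_sub_marginal τ ρ hib hjb1.le hρ
  have hle := mul_le_mul_of_nonneg_right hmass hcost
  rw [hupd]
  constructor
  · linarith
  · intro h
    linarith

end Params
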